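/- Let m be a square-free positive integer with m ≡ 3 (mod 4), let θ = m^(1/4), K = ℚ(i, θ), and let α be any element of the ring of integers O_K. Define, using the eight embeddings σ_{j,k} of K into ℂ (where σ_{j,k}(i) = (−1)^{j−1} i and σ_{j,k}(θ) = i^{k−1} θ for j ∈ {1,2}, k ∈ {1,2,3,4}), writing α^{(j,k)} = σ_{j,k}(α): S₁ = ∏_{j=1}^{2} (α^{(j,1)}−α^{(j,2)})(α^{(j,2)}−α^{(j,3)})(α^{(j,3)}−α^{(j,4)})(α^{(j,4)}−α^{(j,1)}), S₂ = ∏_{j=1}^{2} (α^{(j,1)}−α^{(j,3)})(α^{(j,2)}−α^{(j,4)}), S₃ = ∏_{k=1}^{4} (α^{(1,k)}−α^{(2,k)}), S₄ = (α^{(1,1)}−α^{(2,4)})(α^{(1,2)}−α^{(2,1)})(α^{(1,3)}−α^{(2,2)})(α^{(1,4)}−α^{(2,3)}), S₅ = (α^{(1,1)}−α^{(2,3)})(α^{(1,2)}−α^{(2,4)})(α^{(1,3)}−α^{(2,1)})(α^{(1,4)}−α^{(2,2)}), S₆ = (α^{(1,1)}−α^{(2,2)})(α^{(1,2)}−α^{(2,3)})(α^{(1,3)}−α^{(2,4)})(α^{(1,4)}−α^{(2,1)}).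 Then S₁, …, S₆ are rational integers, m² divides S₁, 16m divides S₂, and 4 divides each of S₄ and S₆. -/

import Mathlib

open NumberField

/-- The real positive fourth root of `m`, viewed as a complex number. -/
noncomputable def theta (m : ℕ) : ℂ := ((m : ℝ) ^ ((1 : ℝ) / 4) : ℝ)

/-- The octic field `K = ℚ(i, m^(1/4))` as a subfield of `ℂ`. -/
noncomputable def Kfield (m : ℕ) : IntermediateField ℚ ℂ :=
  IntermediateField.adjoin ℚ {Complex.I, theta m}

/-- The conjugates `α^(j,k) = σ_{j,k}(α)` of `α ∈ O_K` under a family of embeddings. -/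
noncomputable def conjs (m : ℕ) (σ : Fin 2 → Fin 4 → (Kfield m →ₐ[ℚ] ℂ))
    (α : 𝓞 (Kfield m)) (j : Fin 2) (k : Fin 4) : ℂ :=
  σ j k (algebraMap (𝓞 (Kfield m)) (Kfield m) α)

/-- `S₁`, formed from a system `a j k` of conjugates. -/
noncomputable def S1 (a : Fin 2 → Fin 4 → ℂ) : ℂ :=
  ∏ j : Fin 2, ((a j 0 - a j 1) * (a j 1 - a j 2) * (a j 2 - a j 3) * (a j 3 - a j 0))

/-- `S₂`, formed from a system `a j k` of conjugates. -/
noncomputable def S2 (a : Fin 2 → Fin 4 → ℂ) : ℂ :=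
  ∏ j : Fin 2, ((a j 0 - a j 2) * (a j 1 - a j 3))

/-- `S₃`, formed from a system `a j k` of conjugates. -/
noncomputable def S3 (a : Fin 2 → Fin 4 → ℂ) : ℂ :=
  (a 0 0 - a 1 0) * (a 0 1 - a 1 1) * (a 0 2 - a 1 2) * (a 0 3 - a 1 3)

/-- `S₄`, formed from a system `a j k` of conjugates. -/
noncomputable def S4 (a : Fin 2 → Fin 4 → ℂ) : ℂ :=
  (a 0 0 - a 1 3) * (a 0 1 - a 1 0) * (a 0 2 - a 1 1) * (a 0 3 - a 1 2)

/-- `S₅`, formed from a system `a j k` of conjugates. -/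
noncomputable def S5 (a : Fin 2 → Fin 4 → ℂ) : ℂ :=
  (a 0 0 - a 1 2) * (a 0 1 - a 1 3) * (a 0 2 - a 1 0) * (a 0 3 - a 1 1)

/-- `S₆`, formed from a system `a j k` of conjugates. -/
noncomputable def S6 (a : Fin 2 → Fin 4 → ℂ) : ℂ :=
  (a 0 0 - a 1 1) * (a 0 1 - a 1 2) * (a 0 2 - a 1 3) * (a 0 3 - a 1 0)

open Complex in
theorem theta_pow_four (m : ℕ) : theta m ^ 4 = m := by
  unfold theta
  rw [← ofReal_pow, ← Real.rpow_natCast, ← Real.rpow_mul (Nat.cast_nonneg m)]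
  norm_num

theorem isIntegral_theta (m : ℕ) : IsIntegral ℤ (theta m) := by
  refine IsIntegral.of_pow (n := 4) (by norm_num) ?_
  rw [theta_pow_four]
  exact_mod_cast isIntegral_algebraMap (R := ℤ) (A := ℂ) (x := (m : ℤ))

theorem isIntegral_complex_I : IsIntegral ℤ Complex.I := by
  refine IsIntegral.of_pow (n := 2) (by norm_num) ?_
  rw [Complex.I_sq]
  exact isIntegral_one.neg

/-- The subalgebra `ℚ(i)` of `ℂ`, by coordinates. -/
def gaussRat : Subalgebra ℚ ℂ where
  carrier := {z | ∃ a b : ℚ, z = a + b * Complex.I}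
  mul_mem' := by
    rintro _ _ ⟨a, b, rfl⟩ ⟨c, d, rfl⟩
    refine ⟨a * c - b * d, a * d + b * c, ?_⟩
    push_cast
    linear_combination (b * d : ℂ) * Complex.I_sq
  add_mem' := by
    rintro _ _ ⟨a, b, rfl⟩ ⟨c, d, rfl⟩
    refine ⟨a + c, b + d, ?_⟩
    push_cast
    ring
  algebraMap_mem' r := ⟨r, 0, by simp⟩

theorem I_mem_gaussRat : Complex.I ∈ gaussRat := ⟨0, 1, by simp⟩

theorem natCast_mem_gaussRat (n : ℕ) : (n : ℂ) ∈ gaussRat := ⟨n, 0, by simp⟩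

theorem exists_coords_of_mem_Kfield (m : ℕ) {x : ℂ} (hx : x ∈ Kfield m) :
    ∃ a ∈ gaussRat, ∃ b ∈ gaussRat, ∃ c ∈ gaussRat, ∃ d ∈ gaussRat,
      x = a + b * theta m + c * theta m ^ 2 + d * theta m ^ 3 := by
  have halg : ∀ y ∈ ({Complex.I, theta m} : Set ℂ), IsAlgebraic ℚ y := by
    rintro y (rfl | rfl)
    · exact (isIntegral_complex_I.tower_top (A := ℚ)).isAlgebraic
    · exact ((isIntegral_theta m).tower_top (A := ℚ)).isAlgebraic
  have hx' : x ∈ Algebra.adjoin ℚ ({Complex.I, theta m} : Set ℂ) := by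
    rw [← IntermediateField.adjoin_toSubalgebra_of_isAlgebraic halg]
    exact hx
  have h0 := zero_mem gaussRat
  have hm := natCast_mem_gaussRat m
  induction hx' using Algebra.adjoin_induction with
  | mem y hy =>
    rcases hy with rfl | rfl
    · exact ⟨_, I_mem_gaussRat, 0, h0, 0, h0, 0, h0, by simp⟩
    · exact ⟨0, h0, 1, one_mem _, 0, h0, 0, h0, by simp⟩
  | algebraMap r => exact ⟨_, gaussRat.algebraMap_mem r, 0, h0, 0, h0, 0, h0, by simp⟩
  | add y z hy hz ihy ihz =>
    rw [← IntermediateField.adjoin_toSubalgebra_of_isAlgebraic halg] at hy hz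
    obtain ⟨a, ha, b, hb, c, hc, d, hd, rfl⟩ := ihy hy
    obtain ⟨a', ha', b', hb', c', hc', d', hd', rfl⟩ := ihz hz
    exact ⟨_, add_mem ha ha', _, add_mem hb hb', _, add_mem hc hc', _, add_mem hd hd', by ring⟩
  | mul y z hy hz ihy ihz =>
    rw [← IntermediateField.adjoin_toSubalgebra_of_isAlgebraic halg] at hy hz
    obtain ⟨a, ha, b, hb, c, hc, d, hd, rfl⟩ := ihy hy
    obtain ⟨a', ha', b', hb', c', hc', d', hd', rfl⟩ := ihz hz
    refine ⟨a * a' + m * (b * d' + c * c' + d * b'), ?_,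
      a * b' + b * a' + m * (c * d' + d * c'), ?_,
      a * c' + b * b' + c * a' + m * (d * d'), ?_,
      a * d' + b * c' + c * b' + d * a', ?_, ?_⟩
    · exact add_mem (mul_mem ha ha') (mul_mem hm
        (add_mem (add_mem (mul_mem hb hd') (mul_mem hc hc')) (mul_mem hd hb')))
    · exact add_mem (add_mem (mul_mem ha hb') (mul_mem hb ha')) (mul_mem hm
        (add_mem (mul_mem hc hd') (mul_mem hd hc')))
    · exact add_mem (add_mem (add_mem (mul_mem ha hc') (mul_mem hb hb')) (mul_mem hc ha'))
        (mul_mem hm (mul_mem hd hd'))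
    · exact add_mem (add_mem (add_mem (mul_mem ha hd') (mul_mem hb hc')) (mul_mem hc hb'))
        (mul_mem hd ha')
    · linear_combination ((b * d' + c * c' + d * b') + (c * d' + d * c') * theta m
        + d * d' * theta m ^ 2) * theta_pow_four m

theorem exists_int_of_isIntegral_ratCast {q : ℚ} (h : IsIntegral ℤ (q : ℂ)) : ∃ n : ℤ, q = n := by
  have hq : IsIntegral ℤ q := by
    rw [← isIntegral_algebraMap_iff (B := ℂ) (algebraMap ℚ ℂ).injective]
    exact h
  obtain ⟨n, hn⟩ := IsIntegrallyClosed.isIntegral_iff.mp hq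
  exact ⟨n, by simpa using hn.symm⟩

/-- An algebraic integer in `ℚ(i)` is a Gaussian integer. -/
theorem exists_gaussianInt_of_isIntegral {z : ℂ} (hz : z ∈ gaussRat) (h : IsIntegral ℤ z) :
    ∃ g : GaussianInt, z = g := by
  obtain ⟨a, b, rfl⟩ := hz
  have hconj : IsIntegral ℤ ((a : ℂ) - b * Complex.I) := by
    have := h.map ((starRingEnd ℂ).toIntAlgHom)
    simpa [sub_eq_add_neg] using this
  obtain ⟨p, hp⟩ := exists_int_of_isIntegral_ratCast (q := 2 * a) (by
    have e : ((2 * a : ℚ) : ℂ) = (a + b * Complex.I) + (a - b * Complex.I) := by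
      push_cast
      ring
    rw [e]
    exact h.add hconj)
  obtain ⟨q, hq⟩ := exists_int_of_isIntegral_ratCast (q := 2 * b) (by
    have e : ((2 * b : ℚ) : ℂ) =
        ((a - b * Complex.I) - (a + b * Complex.I)) * Complex.I := by
      push_cast
      linear_combination (2 * b : ℂ) * Complex.I_sq
    rw [e]
    exact (hconj.sub h).mul isIntegral_complex_I)
  obtain ⟨r, hr⟩ := exists_int_of_isIntegral_ratCast (q := a ^ 2 + b ^ 2) (by
    have e : ((a ^ 2 + b ^ 2 : ℚ) : ℂ) = (a + b * Complex.I) * (a - b * Complex.I) := by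
      push_cast
      linear_combination (b ^ 2 : ℂ) * Complex.I_sq
    rw [e]
    exact h.mul hconj)
  have hsum : p ^ 2 + q ^ 2 = 4 * r := by
    have : (p : ℚ) ^ 2 + q ^ 2 = 4 * r := by rw [← hp, ← hq, ← hr]; ring
    exact_mod_cast this
  have key : 2 ∣ p ∧ 2 ∣ q := by
    rcases Int.even_or_odd' p with ⟨s, rfl | rfl⟩ <;> rcases Int.even_or_odd' q with ⟨t, rfl | rfl⟩
    · exact ⟨⟨s, rfl⟩, ⟨t, rfl⟩⟩
    all_goals ring_nf at hsum; omega
  obtain ⟨⟨s, rfl⟩, ⟨t, rfl⟩⟩ := key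
  refine ⟨⟨s, t⟩, ?_⟩
  have ha : a = s := by push_cast at hp; linarith
  have hb : b = t := by push_cast at hq; linarith
  rw [GaussianInt.toComplex_def₂, ha, hb]
  apply Complex.ext <;> simp

theorem natCast_dvd_gaussianInt_iff {m : ℕ} {v : GaussianInt} :
    (m : GaussianInt) ∣ v ↔ (m : ℤ) ∣ v.re ∧ (m : ℤ) ∣ v.im := by
  exact_mod_cast Zsqrtd.intCast_dvd (m : ℤ) v

theorem natCast_dvd_of_dvd_sq {m : ℕ} (hm : Squarefree m) (hodd : Odd m) {v : GaussianInt}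
    (h : (m : GaussianInt) ∣ v ^ 2) : (m : GaussianInt) ∣ v := by
  have hm' : Squarefree (m : ℤ) := Int.squarefree_natCast.mpr hm
  rw [natCast_dvd_gaussianInt_iff] at h ⊢
  obtain ⟨h1, h2⟩ := h
  have h1 : (m : ℤ) ∣ v.re ^ 2 - v.im ^ 2 := by
    convert h1 using 1; simp [pow_two]; ring
  have h2 : (m : ℤ) ∣ 2 * (v.re * v.im) := by
    convert h2 using 1; simp [pow_two]; ring
  have h2 : (m : ℤ) ∣ v.re * v.im := by
    refine IsCoprime.dvd_of_dvd_mul_left ?_ h2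
    rw [Int.isCoprime_iff_gcd_eq_one]
    simpa [Int.gcd] using hodd
  constructor
  · rw [← hm'.dvd_pow_iff_dvd (n := 4) (by norm_num)]
    convert (h1.mul_left (v.re ^ 2)).add (h2.mul_left (v.re * v.im)) using 1
    ring
  · rw [← hm'.dvd_pow_iff_dvd (n := 4) (by norm_num)]
    convert (h2.mul_left (v.re * v.im)).sub (h1.mul_left (v.im ^ 2)) using 1
    ring

theorem exists_gaussianInt_of_isIntegral_mul_theta_cube {m : ℕ} (hm : Squarefree m)
    (hodd : Odd m) {u : ℂ} (hu : u ∈ gaussRat) (h : IsIntegral ℤ (u * theta m ^ 3)) :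
    ∃ g : GaussianInt, u = g := by
  have hθ := theta_pow_four m
  have hmQ := natCast_mem_gaussRat m
  have hm0 : (m : ℂ) ≠ 0 := Nat.cast_ne_zero.mpr hm.ne_zero
  obtain ⟨v, hv⟩ := exists_gaussianInt_of_isIntegral (mul_mem hu hmQ) (by
    have e : u * m = u * theta m ^ 3 * theta m := by linear_combination -u * hθ
    rw [e]
    exact h.mul (isIntegral_theta m))
  obtain ⟨g, hg⟩ := exists_gaussianInt_of_isIntegral
    (mul_mem (pow_mem hu 4) (pow_mem hmQ 3)) (by
      have e : u ^ 4 * (m : ℂ) ^ 3 = (u * theta m ^ 3) ^ 4 := by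
        rw [← hθ]
        ring
      rw [e]
      exact h.pow 4)
  have hvg : v ^ 4 = m * g := by
    rw [← GaussianInt.toComplex_inj]
    rw [map_pow, map_mul, map_natCast, ← hv, ← hg]
    ring
  obtain ⟨w, hw⟩ : (m : GaussianInt) ∣ v := by
    apply natCast_dvd_of_dvd_sq hm hodd
    apply natCast_dvd_of_dvd_sq hm hodd
    exact ⟨g, by rw [← hvg]; ring⟩
  refine ⟨w, mul_right_cancel₀ hm0 ?_⟩
  rw [hv, hw, map_mul, map_natCast, mul_comm]

theorem toComplex_unit_I : ((⟨0, 1⟩ : GaussianInt) : ℂ) = Complex.I := by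
  simp [GaussianInt.toComplex_def₂, Complex.ext_iff]

theorem unit_I_sq : (⟨0, 1⟩ : GaussianInt) ^ 2 = -1 := by
  ext <;> simp [pow_two]

theorem two_dvd_sub_of_four_dvd {m : ℕ} (h3 : m % 4 = 3) {e f k : GaussianInt}
    (h : e ^ 2 - m * f ^ 2 = 4 * k) : ∃ x, e - ⟨0, 1⟩ * f = 2 * x := by
  obtain ⟨n, rfl⟩ : ∃ n, m = 4 * n + 3 := ⟨m / 4, by omega⟩
  obtain ⟨e1, e2⟩ := e
  obtain ⟨f1, f2⟩ := f
  obtain ⟨k1, k2⟩ := k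
  have hre := congrArg Zsqrtd.re h
  have him := congrArg Zsqrtd.im h
  simp [pow_two] at hre him
  have key : (2 : ℤ) ∣ e1 + f2 ∧ (2 : ℤ) ∣ e2 - f1 := by
    rcases Int.even_or_odd' e1 with ⟨a, rfl | rfl⟩ <;>
      rcases Int.even_or_odd' e2 with ⟨b, rfl | rfl⟩ <;>
      rcases Int.even_or_odd' f1 with ⟨c, rfl | rfl⟩ <;>
      rcases Int.even_or_odd' f2 with ⟨d, rfl | rfl⟩ <;>
      ring_nf at hre him <;> omega
  obtain ⟨⟨s, hs⟩, ⟨t, ht⟩⟩ := key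
  refine ⟨⟨s, t⟩, ?_⟩
  ext <;> simp <;> linarith

/-- Coordinates of an algebraic integer `P + Q √m` of `ℚ(i, √m)` with respect to the basis
`1, (1 - i √m) / 2` over `ℤ[i]`. -/
theorem exists_coords_of_isIntegral_quadratic {m : ℕ} (hm : Squarefree m) (h3 : m % 4 = 3)
    {P Q : ℂ} (hP : P ∈ gaussRat) (hQ : Q ∈ gaussRat)
    (h1 : IsIntegral ℤ (P + Q * theta m ^ 2)) (h2 : IsIntegral ℤ (P - Q * theta m ^ 2)) :
    ∃ x y : GaussianInt, P = x + y / 2 ∧ Q = -Complex.I * y / 2 := by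
  have hodd : Odd m := Nat.odd_iff.mpr (by omega)
  have two_mem : (2 : ℂ) ∈ gaussRat := by exact_mod_cast natCast_mem_gaussRat 2
  obtain ⟨E, hE⟩ := exists_gaussianInt_of_isIntegral (mul_mem two_mem hP) (by
    have e : 2 * P = (P + Q * theta m ^ 2) + (P - Q * theta m ^ 2) := by ring
    rw [e]
    exact h1.add h2)
  obtain ⟨F, hF⟩ := exists_gaussianInt_of_isIntegral_mul_theta_cube hm hodd
    (mul_mem two_mem hQ) (by
      have e : 2 * Q * theta m ^ 3 =
          ((P + Q * theta m ^ 2) - (P - Q * theta m ^ 2)) * theta m := by ring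
      rw [e]
      exact (h1.sub h2).mul (isIntegral_theta m))
  obtain ⟨g, hg⟩ := exists_gaussianInt_of_isIntegral (z := P ^ 2 - m * Q ^ 2)
    (sub_mem (pow_mem hP 2) (mul_mem (natCast_mem_gaussRat m) (pow_mem hQ 2))) (by
      have e : P ^ 2 - m * Q ^ 2 = (P + Q * theta m ^ 2) * (P - Q * theta m ^ 2) := by
        linear_combination Q ^ 2 * theta_pow_four m
      rw [e]
      exact h1.mul h2)
  obtain ⟨x, hx⟩ := two_dvd_sub_of_four_dvd h3 (e := E) (f := F) (k := g) (by
    rw [← GaussianInt.toComplex_inj]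
    simp only [map_sub, map_mul, map_pow, map_natCast, map_ofNat, ← hE, ← hF, ← hg]
    ring)
  have hx' := congrArg GaussianInt.toComplex hx
  simp only [map_sub, map_mul, map_ofNat, toComplex_unit_I, ← hE, ← hF] at hx'
  refine ⟨x, ⟨0, 1⟩ * F, ?_, ?_⟩ <;>
    simp only [map_mul, toComplex_unit_I, ← hF]
  · linear_combination hx' / 2
  · linear_combination Q * Complex.I_sq

theorem exists_eq_one_add_I_mul {x : GaussianInt} (h : Even (x.re + x.im)) :
    ∃ y, x = ⟨1, 1⟩ * y := by
  obtain ⟨s, hs⟩ := h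
  refine ⟨⟨s, s - x.re⟩, ?_⟩
  ext <;> simp
  linarith

/-- If `x + y ω` squared agrees with `√m` times the square of `z + w ω` modulo `2`, where
`m = 4 n - 1` and `ω = (1 - i √m) / 2`, then `1 + i` divides all coordinates. -/
theorem one_add_I_dvd_of_two_dvd {n : ℤ} {x y z w k l : GaussianInt}
    (h1 : x ^ 2 - n * y ^ 2 + ⟨0, 1⟩ * (z ^ 2 - n * w ^ 2 + 2 * n * (2 * z * w + w ^ 2)) = 2 * k)
    (h2 : 2 * x * y + y ^ 2 - ⟨0, 1⟩ * (2 * (z ^ 2 - n * w ^ 2) + 2 * z * w + w ^ 2) = 2 * l) :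
    ∃ x' y' z' w' : GaussianInt,
      x = ⟨1, 1⟩ * x' ∧ y = ⟨1, 1⟩ * y' ∧ z = ⟨1, 1⟩ * z' ∧ w = ⟨1, 1⟩ * w' := by
  have hsq (t : ℤ) : t ^ 2 % 2 = t % 2 := by
    rcases Int.emod_two_eq_zero_or_one t with h | h <;> simp [pow_two, Int.mul_emod, h]
  have hre := congrArg Zsqrtd.re h2
  have him := congrArg Zsqrtd.im h2
  simp [pow_two] at hre him
  ring_nf at hre him
  have hy : Even (y.re + y.im) := by
    have := hsq y.re
    have := hsq y.im
    rw [Int.even_iff]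
    omega
  have hw : Even (w.re + w.im) := by
    have := hsq w.re
    have := hsq w.im
    rw [Int.even_iff]
    omega
  obtain ⟨y', rfl⟩ := exists_eq_one_add_I_mul hy
  obtain ⟨w', rfl⟩ := exists_eq_one_add_I_mul hw
  clear hre him
  have hre := congrArg Zsqrtd.re h1
  have him := congrArg Zsqrtd.im h1
  simp [pow_two] at hre him
  ring_nf at hre him
  have hx : Even (x.re + x.im) := by
    have := hsq x.re
    have := hsq x.im
    rw [Int.even_iff]
    omega
  have hz : Even (z.re + z.im) := by
    have := hsq z.re
    have := hsq z.im
    rw [Int.even_iff]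
    omega
  obtain ⟨x', rfl⟩ := exists_eq_one_add_I_mul hx
  obtain ⟨z', rfl⟩ := exists_eq_one_add_I_mul hz
  exact ⟨x', y', z', w', rfl, rfl, rfl, rfl⟩

theorem two_dvd_of_four_dvd_coords {n : ℤ} {x y z w k l : GaussianInt}
    (h1 : x ^ 2 - n * y ^ 2 + ⟨0, 1⟩ * (z ^ 2 - n * w ^ 2 + 2 * n * (2 * z * w + w ^ 2)) = 4 * k)
    (h2 : 2 * x * y + y ^ 2 - ⟨0, 1⟩ * (2 * (z ^ 2 - n * w ^ 2) + 2 * z * w + w ^ 2) = 4 * l) :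
    ∃ x' y' z' w' : GaussianInt, x = 2 * x' ∧ y = 2 * y' ∧ z = 2 * z' ∧ w = 2 * w' := by
  obtain ⟨x, y, z, w, rfl, rfl, rfl, rfl⟩ := one_add_I_dvd_of_two_dvd
    (k := 2 * k) (l := 2 * l) (h1.trans (by ring)) (h2.trans (by ring))
  have hsq : (⟨1, 1⟩ : GaussianInt) ^ 2 = ⟨0, 2⟩ := by ext <;> simp [pow_two]
  have hI : (⟨0, 2⟩ : GaussianInt) = 2 * ⟨0, 1⟩ := by ext <;> simp
  have h0 : (2 : GaussianInt) * ⟨0, 1⟩ ≠ 0 := by decide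
  obtain ⟨x, y, z, w, rfl, rfl, rfl, rfl⟩ := one_add_I_dvd_of_two_dvd (n := n)
    (x := x) (y := y) (z := z) (w := w) (k := -⟨0, 1⟩ * k) (l := -⟨0, 1⟩ * l)
    (mul_left_cancel₀ h0 (by
      rw [hI] at hsq
      linear_combination h1 - (x ^ 2 - n * y ^ 2 +
        ⟨0, 1⟩ * (z ^ 2 - n * w ^ 2 + 2 * n * (2 * z * w + w ^ 2))) * hsq + 4 * k * unit_I_sq))
    (mul_left_cancel₀ h0 (by
      rw [hI] at hsq
      linear_combination h2 - (2 * x * y + y ^ 2 -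
        ⟨0, 1⟩ * (2 * (z ^ 2 - n * w ^ 2) + 2 * z * w + w ^ 2)) * hsq + 4 * l * unit_I_sq))
  refine ⟨⟨0, 1⟩ * x, ⟨0, 1⟩ * y, ⟨0, 1⟩ * z, ⟨0, 1⟩ * w, ?_, ?_, ?_, ?_⟩ <;>
    rw [← mul_assoc, ← mul_assoc, ← pow_two, hsq, hI]

/-- Coordinates of the integers of `K` when `m ≡ 3 (mod 4)`: with `ω = (1 - i θ²) / 2`,
they lie in the `ℤ[i]`-span of `1, ω, θ, θ ω`. -/
theorem exists_coords_of_isIntegral {m : ℕ} (hm : Squarefree m) (h3 : m % 4 = 3)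
    {a b c d : ℂ} (ha : a ∈ gaussRat) (hb : b ∈ gaussRat) (hc : c ∈ gaussRat)
    (hd : d ∈ gaussRat)
    (t0 : IsIntegral ℤ (a + b * theta m + c * theta m ^ 2 + d * theta m ^ 3))
    (t1 : IsIntegral ℤ
      (a + Complex.I * b * theta m - c * theta m ^ 2 - Complex.I * d * theta m ^ 3))
    (t2 : IsIntegral ℤ (a - b * theta m + c * theta m ^ 2 - d * theta m ^ 3))
    (t3 : IsIntegral ℤ
      (a - Complex.I * b * theta m - c * theta m ^ 2 + Complex.I * d * theta m ^ 3)) :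
    ∃ x y z w : GaussianInt, a = x + y / 2 ∧ c = -Complex.I * y / 2 ∧
      b = z + w / 2 ∧ d = -Complex.I * w / 2 := by
  have hodd : Odd m := Nat.odd_iff.mpr (by omega)
  have two_mem : (2 : ℂ) ∈ gaussRat := by exact_mod_cast natCast_mem_gaussRat 2
  have four_mem : (4 : ℂ) ∈ gaussRat := by exact_mod_cast natCast_mem_gaussRat 4
  have hmQ := natCast_mem_gaussRat m
  have hθ := theta_pow_four m
  have hθi := isIntegral_theta m
  have hIi := isIntegral_complex_I
  set θ := theta m with hθdef
  obtain ⟨x, y, hax, hcy⟩ := exists_coords_of_isIntegral_quadratic hm h3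
    (P := 2 * a) (Q := 2 * c) (mul_mem two_mem ha) (mul_mem two_mem hc)
    (by
      have e : 2 * a + 2 * c * θ ^ 2 = (a + b * θ + c * θ ^ 2 + d * θ ^ 3)
          + (a - b * θ + c * θ ^ 2 - d * θ ^ 3) := by ring
      rw [e]
      exact t0.add t2)
    (by
      have e : 2 * a - 2 * c * θ ^ 2 =
          (a + Complex.I * b * θ - c * θ ^ 2 - Complex.I * d * θ ^ 3)
          + (a - Complex.I * b * θ - c * θ ^ 2 + Complex.I * d * θ ^ 3) := by ring
      rw [e]
      exact t1.add t3)
  obtain ⟨p, q, hbp, hdq⟩ := exists_coords_of_isIntegral_quadratic hm h3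
    (P := m * (2 * b)) (Q := m * (2 * d)) (mul_mem hmQ (mul_mem two_mem hb))
    (mul_mem hmQ (mul_mem two_mem hd))
    (by
      have e : m * (2 * b) + m * (2 * d) * θ ^ 2 =
        θ ^ 3 * ((a + b * θ + c * θ ^ 2 + d * θ ^ 3)
          - (a - b * θ + c * θ ^ 2 - d * θ ^ 3)) := by
        rw [← hθ]
        ring
      rw [e]
      exact (hθi.pow 3).mul (t0.sub t2))
    (by
      have e : m * (2 * b) - m * (2 * d) * θ ^ 2 =
        Complex.I * (θ ^ 3 * ((a - Complex.I * b * θ - c * θ ^ 2 + Complex.I * d * θ ^ 3)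
          - (a + Complex.I * b * θ - c * θ ^ 2 - Complex.I * d * θ ^ 3))) := by
        rw [← hθ]
        linear_combination (2 * b * θ ^ 4 - 2 * d * θ ^ 6) * Complex.I_sq
      rw [e]
      exact hIi.mul ((hθi.pow 3).mul (t3.sub t1)))
  obtain ⟨G, hG⟩ := exists_gaussianInt_of_isIntegral_mul_theta_cube hm hodd
    (mul_mem four_mem hb) (by
      have e : 4 * b * theta m ^ 3 = θ ^ 2 * ((a + b * θ + c * θ ^ 2 + d * θ ^ 3)
          - (a - b * θ + c * θ ^ 2 - d * θ ^ 3) +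
          Complex.I * ((a - Complex.I * b * θ - c * θ ^ 2 + Complex.I * d * θ ^ 3)
          - (a + Complex.I * b * θ - c * θ ^ 2 - Complex.I * d * θ ^ 3))) := by
        linear_combination (2 * b * θ ^ 3 - 2 * d * θ ^ 5) * Complex.I_sq
      rw [e]
      exact (hθi.pow 2).mul ((t0.sub t2).add (hIi.mul (t3.sub t1))))
  obtain ⟨H, hH⟩ := exists_gaussianInt_of_isIntegral_mul_theta_cube hm hodd
    (mul_mem four_mem hd) (by
      have e : 4 * d * theta m ^ 3 = (a + b * θ + c * θ ^ 2 + d * θ ^ 3)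
          - (a - b * θ + c * θ ^ 2 - d * θ ^ 3) +
          Complex.I * ((a + Complex.I * b * θ - c * θ ^ 2 - Complex.I * d * θ ^ 3)
          - (a - Complex.I * b * θ - c * θ ^ 2 + Complex.I * d * θ ^ 3)) := by
        linear_combination (2 * d * θ ^ 3 - 2 * b * θ) * Complex.I_sq
      rw [e]
      exact (t0.sub t2).add (hIi.mul (t1.sub t3)))
  obtain ⟨r, hr⟩ : ∃ r, m = 2 * r + 1 := hodd
  obtain ⟨z, hz⟩ : ∃ z : GaussianInt, 2 * b - Complex.I * (2 * d) = z := by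
    refine ⟨p - r * (G - ⟨0, 1⟩ * H), ?_⟩
    have hr' : (m : ℂ) = 2 * r + 1 := by exact_mod_cast hr
    rw [hr'] at hbp hdq
    simp only [map_sub, map_mul, map_natCast, toComplex_unit_I, ← hG, ← hH]
    linear_combination hbp - Complex.I * hdq + q / 2 * Complex.I_sq
  obtain ⟨w, hw⟩ : ∃ w : GaussianInt, 2 * Complex.I * (2 * d) = w :=
    ⟨⟨0, 1⟩ * H, by simp only [map_mul, toComplex_unit_I, ← hH]; ring⟩
  have hbz : 2 * b = z + w / 2 := by linear_combination hz + hw / 2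
  have hdw : 2 * d = -Complex.I * w / 2 := by
    linear_combination -Complex.I / 2 * hw + 2 * d * Complex.I_sq
  obtain ⟨g, f, hg, hf⟩ := exists_coords_of_isIntegral_quadratic hm h3
    (P := a ^ 2 + m * c ^ 2 - 2 * m * b * d) (Q := 2 * a * c - b ^ 2 - m * d ^ 2)
    (sub_mem (add_mem (pow_mem ha 2) (mul_mem hmQ (pow_mem hc 2)))
      (mul_mem (mul_mem (mul_mem two_mem hmQ) hb) hd))
    (sub_mem (sub_mem (mul_mem (mul_mem two_mem ha) hc) (pow_mem hb 2))
      (mul_mem hmQ (pow_mem hd 2)))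
    (by
      have e : a ^ 2 + m * c ^ 2 - 2 * m * b * d + (2 * a * c - b ^ 2 - m * d ^ 2) * θ ^ 2 =
        (a + b * θ + c * θ ^ 2 + d * θ ^ 3) * (a - b * θ + c * θ ^ 2 - d * θ ^ 3) := by
        rw [← hθ]
        ring
      rw [e]
      exact t0.mul t2)
    (by
      have e : a ^ 2 + m * c ^ 2 - 2 * m * b * d - (2 * a * c - b ^ 2 - m * d ^ 2) * θ ^ 2 =
        (a + Complex.I * b * θ - c * θ ^ 2 - Complex.I * d * θ ^ 3) *
          (a - Complex.I * b * θ - c * θ ^ 2 + Complex.I * d * θ ^ 3) := by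
        rw [← hθ]
        linear_combination (b * θ - d * θ ^ 3) ^ 2 * Complex.I_sq
      rw [e]
      exact t1.mul t3)
  obtain ⟨n, hn⟩ : ∃ n : ℤ, (m : ℤ) = 4 * n - 1 := ⟨(m + 1) / 4, by omega⟩
  have hn' : (m : ℂ) = 4 * n - 1 := by exact_mod_cast congrArg (Int.cast : ℤ → ℂ) hn
  have ha' : a = (x + y / 2) / 2 := by linear_combination hax / 2
  have hb' : b = (z + w / 2) / 2 := by linear_combination hbz / 2
  have hc' : c = -Complex.I * y / 4 := by linear_combination hcy / 2
  have hd' : d = -Complex.I * w / 4 := by linear_combination hdw / 2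
  rw [ha', hb', hc', hd', hn'] at hg hf
  obtain ⟨x', y', z', w', rfl, rfl, rfl, rfl⟩ :=
    two_dvd_of_four_dvd_coords (n := n) (x := x) (y := y) (z := z) (w := w) (k := g) (l := f)
    (by
      rw [← GaussianInt.toComplex_inj]
      simp only [map_sub, map_add, map_mul, map_pow, map_intCast, map_ofNat, toComplex_unit_I]
      linear_combination 4 * (hg - Complex.I * hf)
        + (-x * y - n * y ^ 2 - n * Complex.I * w ^ 2 - y ^ 2 / 4 + Complex.I * w ^ 2 / 4
          + 2 * f) * Complex.I_sq)
    (by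
      rw [← GaussianInt.toComplex_inj]
      simp only [map_sub, map_add, map_mul, map_pow, map_intCast, map_ofNat, toComplex_unit_I]
      linear_combination 8 * Complex.I * hf
        + (2 * x * y + y ^ 2 + 2 * n * Complex.I * w ^ 2 - Complex.I * w ^ 2 / 2
          - 4 * f) * Complex.I_sq)
  simp only [map_mul, map_ofNat] at ha' hb' hc' hd'
  exact ⟨x', y', z', w', by rw [ha']; ring, by rw [hc']; ring, by rw [hb']; ring,
    by rw [hd']; ring⟩

/-- The value at `η` of the cubic polynomial with coefficients `a, b, c, d`. -/
def cubicEval (a b c d η : ℂ) : ℂ := a + b * η + c * η ^ 2 + d * η ^ 3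

theorem prod_cubicEval {M θ : ℂ} (hθ : θ ^ 4 = M) (A B C D : ℂ) :
    cubicEval A B C D θ * cubicEval A B C D (Complex.I * θ) * cubicEval A B C D (-θ)
      * cubicEval A B C D (-(Complex.I * θ)) =
    (A ^ 2 + M * C ^ 2 - 2 * M * B * D) ^ 2 - M * (2 * A * C - B ^ 2 - M * D ^ 2) ^ 2 := by
  have h1 : cubicEval A B C D θ * cubicEval A B C D (-θ) =
      (A ^ 2 + M * C ^ 2 - 2 * M * B * D) + (2 * A * C - B ^ 2 - M * D ^ 2) * θ ^ 2 := by
    rw [← hθ]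
    unfold cubicEval
    ring
  have h2 : cubicEval A B C D (Complex.I * θ) * cubicEval A B C D (-(Complex.I * θ)) =
      (A ^ 2 + M * C ^ 2 - 2 * M * B * D) - (2 * A * C - B ^ 2 - M * D ^ 2) * θ ^ 2 := by
    rw [← hθ]
    unfold cubicEval
    ring_nf
    simp only [Complex.I_sq, Complex.I_pow_four, show Complex.I ^ 6 = -1 by
      rw [show 6 = 4 + 2 by rfl, pow_add, Complex.I_sq, Complex.I_pow_four, one_mul]]
    ring
  calc _ = (cubicEval A B C D θ * cubicEval A B C D (-θ)) *
        (cubicEval A B C D (Complex.I * θ) * cubicEval A B C D (-(Complex.I * θ))) := by ring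
    _ = _ := by
      rw [h1, h2, ← hθ]
      ring

section Products

variable {M θ a b c d a' b' c' d' : ℂ} {t : Fin 2 → Fin 4 → ℂ}

/-- A family `t j k` is given by evaluating two cubic polynomials at `i ^ k θ`. -/
structure IsCubicFamily (t : Fin 2 → Fin 4 → ℂ) (θ a b c d a' b' c' d' : ℂ) : Prop where
  t00 : t 0 0 = cubicEval a b c d θ
  t01 : t 0 1 = cubicEval a b c d (Complex.I * θ)
  t02 : t 0 2 = cubicEval a b c d (-θ)
  t03 : t 0 3 = cubicEval a b c d (-(Complex.I * θ))
  t10 : t 1 0 = cubicEval a' b' c' d' θ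
  t11 : t 1 1 = cubicEval a' b' c' d' (Complex.I * θ)
  t12 : t 1 2 = cubicEval a' b' c' d' (-θ)
  t13 : t 1 3 = cubicEval a' b' c' d' (-(Complex.I * θ))

theorem I_mul_I_mul (z : ℂ) : Complex.I * (Complex.I * z) = -z := by
  rw [← mul_assoc, Complex.I_mul_I, neg_one_mul]

theorem cubicEval_sub (η : ℂ) :
    cubicEval a b c d η - cubicEval a' b' c' d' η =
      cubicEval (a - a') (b - b') (c - c') (d - d') η := by
  unfold cubicEval
  ring

theorem cubicEval_neg (η : ℂ) : cubicEval a b c d (-η) = cubicEval a (-b) c (-d) η := by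
  unfold cubicEval
  ring

theorem cubicEval_I_mul (η : ℂ) : cubicEval a b c d (Complex.I * η) =
    cubicEval a (Complex.I * b) (-c) (-Complex.I * d) η := by
  unfold cubicEval
  rw [mul_pow, mul_pow, Complex.I_sq, Complex.I_pow_three]
  ring

theorem cubicEval_sub_neg (η : ℂ) :
    cubicEval a b c d η - cubicEval a' b' c' d' (-η) =
      cubicEval (a - a') (b + b') (c - c') (d + d') η := by
  rw [cubicEval_neg, cubicEval_sub, sub_neg_eq_add, sub_neg_eq_add]

theorem cubicEval_sub_I_mul (η : ℂ) :
    cubicEval a b c d η - cubicEval a' b' c' d' (Complex.I * η) =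
      cubicEval (a - a') (b - Complex.I * b') (c + c') (d + Complex.I * d') η := by
  rw [cubicEval_I_mul, cubicEval_sub, sub_neg_eq_add, neg_mul, sub_neg_eq_add]

theorem cubicEval_sub_neg_I_mul (η : ℂ) :
    cubicEval a b c d η - cubicEval a' b' c' d' (-(Complex.I * η)) =
      cubicEval (a - a') (b + Complex.I * b') (c + c') (d - Complex.I * d') η := by
  rw [cubicEval_neg, cubicEval_I_mul, cubicEval_sub]
  congr 1 <;> ring

theorem prod_cubicEval_sub_rotate (hθ : θ ^ 4 = M) :
    (cubicEval a b c d θ - cubicEval a b c d (Complex.I * θ)) *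
      (cubicEval a b c d (Complex.I * θ) - cubicEval a b c d (-θ)) *
      (cubicEval a b c d (-θ) - cubicEval a b c d (-(Complex.I * θ))) *
      (cubicEval a b c d (-(Complex.I * θ)) - cubicEval a b c d θ) =
    M * (16 * M * (c ^ 2 - b * d) ^ 2 + 4 * (b ^ 2 - M * d ^ 2) ^ 2) := by
  have h := prod_cubicEval hθ (a - a) (b - Complex.I * b) (c + c) (d + Complex.I * d)
  simp only [← cubicEval_sub_I_mul, I_mul_I_mul, mul_neg, neg_neg] at h
  rw [h]
  have hP : (a - a) ^ 2 + M * (c + c) ^ 2 - 2 * M * (b - Complex.I * b) * (d + Complex.I * d) =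
      4 * M * (c ^ 2 - b * d) := by
    linear_combination 2 * M * b * d * Complex.I_sq
  have hQ : 2 * (a - a) * (c + c) - (b - Complex.I * b) ^ 2 - M * (d + Complex.I * d) ^ 2 =
      Complex.I * (2 * (b ^ 2 - M * d ^ 2)) := by
    linear_combination (-b ^ 2 - M * d ^ 2) * Complex.I_sq
  rw [hP, hQ]
  linear_combination -M * (2 * (b ^ 2 - M * d ^ 2)) ^ 2 * Complex.I_sq

theorem IsCubicFamily.S1_eq (h : IsCubicFamily t θ a b c d a' b' c' d') (hθ : θ ^ 4 = M) :
    S1 t = M ^ 2 * ((16 * M * (c ^ 2 - b * d) ^ 2 + 4 * (b ^ 2 - M * d ^ 2) ^ 2) *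
      (16 * M * (c' ^ 2 - b' * d') ^ 2 + 4 * (b' ^ 2 - M * d' ^ 2) ^ 2)) := by
  rw [S1, Fin.prod_univ_two, h.t00, h.t01, h.t02, h.t03, h.t10, h.t11, h.t12, h.t13,
    prod_cubicEval_sub_rotate hθ, prod_cubicEval_sub_rotate hθ]
  ring

theorem IsCubicFamily.S2_eq (h : IsCubicFamily t θ a b c d a' b' c' d') (hθ : θ ^ 4 = M) :
    S2 t = 16 * M * -((b ^ 2 - M * d ^ 2) * (b' ^ 2 - M * d' ^ 2)) := by
  rw [S2, Fin.prod_univ_two, h.t00, h.t01, h.t02, h.t03, h.t10, h.t11, h.t12, h.t13,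
    cubicEval_sub_neg, cubicEval_sub_neg, cubicEval_sub_neg, cubicEval_sub_neg,
    cubicEval_I_mul, cubicEval_I_mul, ← hθ]
  unfold cubicEval
  linear_combination 16 * θ ^ 4 * (b ^ 2 - θ ^ 4 * d ^ 2) * (b' ^ 2 - θ ^ 4 * d' ^ 2) *
    Complex.I_sq

theorem IsCubicFamily.S3_eq (h : IsCubicFamily t θ a b c d a' b' c' d') (hθ : θ ^ 4 = M) :
    S3 t = ((a - a') ^ 2 + M * (c - c') ^ 2 - 2 * M * (b - b') * (d - d')) ^ 2
      - M * (2 * (a - a') * (c - c') - (b - b') ^ 2 - M * (d - d') ^ 2) ^ 2 := by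
  rw [← prod_cubicEval hθ, S3, h.t00, h.t01, h.t02, h.t03, h.t10, h.t11, h.t12, h.t13]
  simp only [← cubicEval_sub]

theorem IsCubicFamily.S4_eq (h : IsCubicFamily t θ a b c d a' b' c' d') (hθ : θ ^ 4 = M) :
    S4 t = ((a - a') ^ 2 + M * (c + c') ^ 2
        - 2 * M * (b + Complex.I * b') * (d - Complex.I * d')) ^ 2
      - M * (2 * (a - a') * (c + c') - (b + Complex.I * b') ^ 2
        - M * (d - Complex.I * d') ^ 2) ^ 2 := by
  rw [← prod_cubicEval hθ, S4, h.t00, h.t01, h.t02, h.t03, h.t10, h.t11, h.t12, h.t13]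
  simp only [← cubicEval_sub_neg_I_mul, I_mul_I_mul, mul_neg, neg_neg]

theorem IsCubicFamily.S5_eq (h : IsCubicFamily t θ a b c d a' b' c' d') (hθ : θ ^ 4 = M) :
    S5 t = ((a - a') ^ 2 + M * (c - c') ^ 2 - 2 * M * (b + b') * (d + d')) ^ 2
      - M * (2 * (a - a') * (c - c') - (b + b') ^ 2 - M * (d + d') ^ 2) ^ 2 := by
  rw [← prod_cubicEval hθ, S5, h.t00, h.t01, h.t02, h.t03, h.t10, h.t11, h.t12, h.t13]
  simp only [← cubicEval_sub_neg, neg_neg]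

theorem IsCubicFamily.S6_eq (h : IsCubicFamily t θ a b c d a' b' c' d') (hθ : θ ^ 4 = M) :
    S6 t = ((a - a') ^ 2 + M * (c + c') ^ 2
        - 2 * M * (b - Complex.I * b') * (d + Complex.I * d')) ^ 2
      - M * (2 * (a - a') * (c + c') - (b - Complex.I * b') ^ 2
        - M * (d + Complex.I * d') ^ 2) ^ 2 := by
  rw [← prod_cubicEval hθ, S6, h.t00, h.t01, h.t02, h.t03, h.t10, h.t11, h.t12, h.t13]
  simp only [← cubicEval_sub_I_mul, I_mul_I_mul, mul_neg, neg_neg]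

end Products

theorem four_dvd_sq_add_mul_sq {M X Y u n : ℤ} (hM : M = 4 * n - 1) (h : X = Y + 2 * u) :
    4 ∣ X ^ 2 + M * Y ^ 2 :=
  ⟨u * Y + u ^ 2 + n * Y ^ 2, by rw [h, hM]; ring⟩

theorem natCast_sq_mul_intCast (m : ℕ) (N : ℤ) :
    (m : ℂ) ^ 2 * N = (((m : ℤ) ^ 2 * N : ℤ) : ℂ) := by
  push_cast
  rfl

theorem sixteen_mul_natCast_mul_neg (m : ℕ) (N : ℤ) :
    16 * (m : ℂ) * -N = ((16 * (m : ℤ) * -N : ℤ) : ℂ) := by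
  push_cast
  rfl

theorem sq_sub_natCast_mul_sq (m : ℕ) (X Y : ℤ) :
    (X : ℂ) ^ 2 - m * (Y : ℂ) ^ 2 = ((X ^ 2 - (m : ℤ) * Y ^ 2 : ℤ) : ℂ) := by
  push_cast
  rfl

theorem sq_add_natCast_mul_sq (m : ℕ) (X Y : ℤ) :
    (X : ℂ) ^ 2 + m * (Y : ℂ) ^ 2 = ((X ^ 2 + (m : ℤ) * Y ^ 2 : ℤ) : ℂ) := by
  push_cast
  rfl

theorem exists_lift_of_mem_gaussRat {m : ℕ} {σ : Fin 2 → Fin 4 → (Kfield m →ₐ[ℚ] ℂ)}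
    (hσI : ∀ (j : Fin 2) (k : Fin 4) (x : Kfield m),
      (x : ℂ) = Complex.I → σ j k x = (-1 : ℂ) ^ (j : ℕ) * Complex.I)
    {a : ℂ} (ha : a ∈ gaussRat) :
    ∃ A : Kfield m, (A : ℂ) = a ∧ ∀ k, σ 0 k A = a ∧ σ 1 k A = starRingEnd ℂ a := by
  obtain ⟨r, s, rfl⟩ := ha
  let i : Kfield m := ⟨Complex.I, IntermediateField.subset_adjoin _ _ (by simp)⟩
  refine ⟨(r : Kfield m) + (s : Kfield m) * i, by simp [i], fun k => ⟨?_, ?_⟩⟩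
  · rw [map_add, map_mul, map_ratCast, map_ratCast, hσI 0 k i rfl]
    simp
  · rw [map_add, map_mul, map_ratCast, map_ratCast, hσI 1 k i rfl]
    simp

theorem exists_isCubicFamily_conjs {m : ℕ} {σ : Fin 2 → Fin 4 → (Kfield m →ₐ[ℚ] ℂ)}
    (hσI : ∀ (j : Fin 2) (k : Fin 4) (x : Kfield m),
      (x : ℂ) = Complex.I → σ j k x = (-1 : ℂ) ^ (j : ℕ) * Complex.I)
    (hσθ : ∀ (j : Fin 2) (k : Fin 4) (x : Kfield m),
      (x : ℂ) = theta m → σ j k x = Complex.I ^ (k : ℕ) * theta m)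
    (α : 𝓞 (Kfield m)) :
    ∃ a ∈ gaussRat, ∃ b ∈ gaussRat, ∃ c ∈ gaussRat, ∃ d ∈ gaussRat,
      IsCubicFamily (conjs m σ α) (theta m) a b c d (starRingEnd ℂ a) (starRingEnd ℂ b)
        (starRingEnd ℂ c) (starRingEnd ℂ d) := by
  obtain ⟨a, ha, b, hb, c, hc, d, hd, hx⟩ :=
    exists_coords_of_mem_Kfield m (algebraMap (𝓞 (Kfield m)) (Kfield m) α).2
  obtain ⟨A, hA, hσA⟩ := exists_lift_of_mem_gaussRat hσI ha
  obtain ⟨B, hB, hσB⟩ := exists_lift_of_mem_gaussRat hσI hb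
  obtain ⟨C, hC, hσC⟩ := exists_lift_of_mem_gaussRat hσI hc
  obtain ⟨D, hD, hσD⟩ := exists_lift_of_mem_gaussRat hσI hd
  let T : Kfield m := ⟨theta m, IntermediateField.subset_adjoin _ _ (by simp)⟩
  have hα : algebraMap (𝓞 (Kfield m)) (Kfield m) α = A + B * T + C * T ^ 2 + D * T ^ 3 := by
    apply Subtype.ext
    rw [hx]
    simp [hA, hB, hC, hD, T]
  have h0 (k : Fin 4) : conjs m σ α 0 k = cubicEval a b c d (Complex.I ^ (k : ℕ) * theta m) := by
    simp only [conjs, hα, map_add, map_mul, map_pow, hσA, hσB, hσC, hσD, hσθ 0 k T rfl, cubicEval]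
  have h1 (k : Fin 4) : conjs m σ α 1 k = cubicEval (starRingEnd ℂ a) (starRingEnd ℂ b)
      (starRingEnd ℂ c) (starRingEnd ℂ d) (Complex.I ^ (k : ℕ) * theta m) := by
    simp only [conjs, hα, map_add, map_mul, map_pow, hσA, hσB, hσC, hσD, hσθ 1 k T rfl, cubicEval]
  exact ⟨a, ha, b, hb, c, hc, d, hd, by constructor <;> simp [h0, h1]⟩

theorem mul_conj_gaussianInt (g : GaussianInt) :
    (g : ℂ) * starRingEnd ℂ (g : ℂ) = (g.norm : ℤ) := by
  rw [Complex.mul_conj, GaussianInt.intCast_complex_norm]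

/-- Case `m ≡ 3 (mod 4)`: the `Sᵢ` are rational integers; `m² ∣ S₁`, `16m ∣ S₂`,
and `4` divides `S₄` and `S₆`. -/
theorem stmt_17 (m : ℕ) (hm : Squarefree m) (hpos : 0 < m) (h3 : m % 4 = 3)
    (σ : Fin 2 → Fin 4 → (Kfield m →ₐ[ℚ] ℂ))
    (hσI : ∀ (j : Fin 2) (k : Fin 4) (x : Kfield m),
      (x : ℂ) = Complex.I → σ j k x = (-1 : ℂ) ^ (j : ℕ) * Complex.I)
    (hσθ : ∀ (j : Fin 2) (k : Fin 4) (x : Kfield m),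
      (x : ℂ) = theta m → σ j k x = Complex.I ^ (k : ℕ) * theta m)
    (α : 𝓞 (Kfield m)) :
    ∃ s₁ s₂ s₃ s₄ s₅ s₆ : ℤ,
      S1 (conjs m σ α) = (s₁ : ℂ) ∧ S2 (conjs m σ α) = (s₂ : ℂ) ∧
      S3 (conjs m σ α) = (s₃ : ℂ) ∧ S4 (conjs m σ α) = (s₄ : ℂ) ∧
      S5 (conjs m σ α) = (s₅ : ℂ) ∧ S6 (conjs m σ α) = (s₆ : ℂ) ∧
      ((m : ℤ) ^ 2) ∣ s₁ ∧ (16 * (m : ℤ)) ∣ s₂ ∧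
      (4 : ℤ) ∣ s₄ ∧ (4 : ℤ) ∣ s₆ := by
  have hθ := theta_pow_four m
  obtain ⟨a, ha, b, hb, c, hc, d, hd, hfam⟩ := exists_isCubicFamily_conjs hσI hσθ α
  have hint (k : Fin 4) : IsIntegral ℤ (conjs m σ α 0 k) :=
    (RingOfIntegers.isIntegral_coe α).map ((σ 0 k).restrictScalars ℤ)
  obtain ⟨x, y, z, w, hax, hcy, hbz, hdw⟩ := exists_coords_of_isIntegral hm h3 ha hb hc hd
    (by
      have := hint 0
      rwa [hfam.t00] at this)
    (by
      have := hint 1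
      rw [hfam.t01, cubicEval_I_mul] at this
      convert this using 1
      unfold cubicEval
      ring)
    (by
      have := hint 2
      rw [hfam.t02, cubicEval_neg] at this
      convert this using 1
      unfold cubicEval
      ring)
    (by
      have := hint 3
      rw [hfam.t03, cubicEval_neg, cubicEval_I_mul] at this
      convert this using 1
      unfold cubicEval
      ring)
  obtain ⟨n, hn⟩ : ∃ n : ℤ, (m : ℤ) = 4 * n - 1 := ⟨(m + 1) / 4, by omega⟩
  have hnC : (m : ℂ) = 4 * n - 1 := by exact_mod_cast congrArg (Int.cast : ℤ → ℂ) hn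
  have hb2 : b ^ 2 - m * d ^ 2 = ((z ^ 2 + z * w + n * w ^ 2 : GaussianInt) : ℂ) := by
    simp only [map_add, map_mul, map_pow, map_intCast]
    rw [hbz, hdw, hnC]
    linear_combination (-(4 * n - 1) * w ^ 2 / 4 : ℂ) * Complex.I_sq
  have hc2 : 4 * (c ^ 2 - b * d) =
      ((-y ^ 2 + ⟨0, 1⟩ * (2 * z * w + w ^ 2) : GaussianInt) : ℂ) := by
    simp only [map_add, map_mul, map_pow, map_neg, map_ofNat, toComplex_unit_I]
    rw [hbz, hdw, hcy]
    linear_combination (y ^ 2 : ℂ) * Complex.I_sq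
  have hG : 16 * m * (c ^ 2 - b * d) ^ 2 + 4 * (b ^ 2 - m * d ^ 2) ^ 2 =
      ((m * (-y ^ 2 + ⟨0, 1⟩ * (2 * z * w + w ^ 2)) ^ 2
        + 4 * (z ^ 2 + z * w + n * w ^ 2) ^ 2 : GaussianInt) : ℂ) := by
    rw [map_add, map_mul, map_mul, map_pow, map_pow, ← hc2, ← hb2, map_natCast, map_ofNat]
    ring
  have hb2' : starRingEnd ℂ b ^ 2 - m * starRingEnd ℂ d ^ 2 =
      starRingEnd ℂ ((z ^ 2 + z * w + n * w ^ 2 : GaussianInt) : ℂ) := by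
    rw [← hb2]
    simp
  have hG' : 16 * m * (starRingEnd ℂ c ^ 2 - starRingEnd ℂ b * starRingEnd ℂ d) ^ 2
        + 4 * (starRingEnd ℂ b ^ 2 - m * starRingEnd ℂ d ^ 2) ^ 2 =
      starRingEnd ℂ ((m * (-y ^ 2 + ⟨0, 1⟩ * (2 * z * w + w ^ 2)) ^ 2
        + 4 * (z ^ 2 + z * w + n * w ^ 2) ^ 2 : GaussianInt) : ℂ) := by
    rw [← hG]
    simp [map_ofNat]
  have hS1 := hfam.S1_eq hθ
  have hS2 := hfam.S2_eq hθ
  rw [hG, hG', mul_conj_gaussianInt] at hS1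
  rw [hb2, hb2', mul_conj_gaussianInt] at hS2
  have hS3 := hfam.S3_eq hθ
  have hS4 := hfam.S4_eq hθ
  have hS5 := hfam.S5_eq hθ
  have hS6 := hfam.S6_eq hθ
  obtain ⟨x₁, x₂⟩ := x
  obtain ⟨y₁, y₂⟩ := y
  obtain ⟨z₁, z₂⟩ := z
  obtain ⟨w₁, w₂⟩ := w
  have hI := Complex.I_sq
  have ha1 : a - starRingEnd ℂ a = Complex.I * (2 * x₂ + y₂) := by
    rw [hax, GaussianInt.toComplex_def', GaussianInt.toComplex_def']
    simp [map_ofNat]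
    ring
  have hc1 : c - starRingEnd ℂ c = -Complex.I * y₁ := by
    rw [hcy, GaussianInt.toComplex_def']
    simp [map_ofNat]
    ring
  have hc_add : c + starRingEnd ℂ c = y₂ := by
    rw [hcy, GaussianInt.toComplex_def']
    simp [map_ofNat]
    linear_combination -(y₂ : ℂ) * hI
  have hb1 : b = z₁ + w₁ / 2 + (z₂ + w₂ / 2) * Complex.I := by
    rw [hbz, GaussianInt.toComplex_def', GaussianInt.toComplex_def']
    ring
  have hd1 : d = w₂ / 2 - w₁ / 2 * Complex.I := by
    rw [hdw, GaussianInt.toComplex_def']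
    linear_combination -(w₂ / 2 : ℂ) * hI
  have hb1' : starRingEnd ℂ b = z₁ + w₁ / 2 - (z₂ + w₂ / 2) * Complex.I := by
    rw [hb1]
    simp [map_ofNat]
    ring
  have hd1' : starRingEnd ℂ d = w₂ / 2 + w₁ / 2 * Complex.I := by
    rw [hd1]
    simp [map_ofNat]
  have hP3 : (a - starRingEnd ℂ a) ^ 2 + m * (c - starRingEnd ℂ c) ^ 2
      - 2 * m * (b - starRingEnd ℂ b) * (d - starRingEnd ℂ d) =
      ((-(2 * x₂ + y₂) ^ 2 - m * y₁ ^ 2 - 2 * m * (2 * z₂ + w₂) * w₁ : ℤ) : ℂ) := by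
    rw [ha1, hc1, hb1', hb1, hd1', hd1]
    push_cast
    linear_combination ((2 * x₂ + y₂) ^ 2 + m * y₁ ^ 2 + 2 * m * (2 * z₂ + w₂) * w₁ : ℂ) * hI
  have hQ3 : 2 * (a - starRingEnd ℂ a) * (c - starRingEnd ℂ c) - (b - starRingEnd ℂ b) ^ 2
      - m * (d - starRingEnd ℂ d) ^ 2 =
      ((2 * (2 * x₂ + y₂) * y₁ + (2 * z₂ + w₂) ^ 2 + m * w₁ ^ 2 : ℤ) : ℂ) := by
    rw [ha1, hc1, hb1', hb1, hd1', hd1]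
    push_cast
    linear_combination
      (-(2 * (2 * x₂ + y₂) * y₁ + (2 * z₂ + w₂) ^ 2 + m * w₁ ^ 2) : ℂ) * hI
  have hP5 : (a - starRingEnd ℂ a) ^ 2 + m * (c - starRingEnd ℂ c) ^ 2
      - 2 * m * (b + starRingEnd ℂ b) * (d + starRingEnd ℂ d) =
      ((-(2 * x₂ + y₂) ^ 2 - m * y₁ ^ 2 - 2 * m * (2 * z₁ + w₁) * w₂ : ℤ) : ℂ) := by
    rw [ha1, hc1, hb1', hb1, hd1', hd1]
    push_cast
    linear_combination ((2 * x₂ + y₂) ^ 2 + m * y₁ ^ 2 : ℂ) * hI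
  have hQ5 : 2 * (a - starRingEnd ℂ a) * (c - starRingEnd ℂ c) - (b + starRingEnd ℂ b) ^ 2
      - m * (d + starRingEnd ℂ d) ^ 2 =
      ((2 * (2 * x₂ + y₂) * y₁ - (2 * z₁ + w₁) ^ 2 - m * w₂ ^ 2 : ℤ) : ℂ) := by
    rw [ha1, hc1, hb1', hb1, hd1', hd1]
    push_cast
    linear_combination (-(2 * (2 * x₂ + y₂) * y₁) : ℂ) * hI
  have hB4 : b + Complex.I * starRingEnd ℂ b =
      (1 + Complex.I) * ((z₁ + z₂) + (w₁ + w₂) / 2) := by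
    rw [hb1', hb1]
    linear_combination (-(z₂ + w₂ / 2) : ℂ) * hI
  have hD4 : d - Complex.I * starRingEnd ℂ d = (1 - Complex.I) * ((w₁ + w₂) / 2) := by
    rw [hd1', hd1]
    linear_combination (-(w₁ / 2) : ℂ) * hI
  have hB6 : b - Complex.I * starRingEnd ℂ b =
      (1 - Complex.I) * ((z₁ - z₂) + (w₁ - w₂) / 2) := by
    rw [hb1', hb1]
    linear_combination ((z₂ + w₂ / 2) : ℂ) * hI
  have hD6 : d + Complex.I * starRingEnd ℂ d = (1 + Complex.I) * (-(w₁ - w₂) / 2) := by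
    rw [hd1', hd1]
    linear_combination (w₁ / 2 : ℂ) * hI
  have hP4 : (a - starRingEnd ℂ a) ^ 2 + m * (c + starRingEnd ℂ c) ^ 2
      - 2 * m * (b + Complex.I * starRingEnd ℂ b) * (d - Complex.I * starRingEnd ℂ d) =
      ((-(2 * x₂ + y₂) ^ 2 + m * y₂ ^ 2
        - m * (2 * (z₁ + z₂) + (w₁ + w₂)) * (w₁ + w₂) : ℤ) : ℂ) := by
    rw [ha1, hc_add, hB4, hD4]
    push_cast
    linear_combination ((2 * x₂ + y₂) ^ 2
      + m * ((z₁ + z₂) + (w₁ + w₂) / 2) * (w₁ + w₂) : ℂ) * hI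
  have hQ4 : 2 * (a - starRingEnd ℂ a) * (c + starRingEnd ℂ c)
      - (b + Complex.I * starRingEnd ℂ b) ^ 2 - m * (d - Complex.I * starRingEnd ℂ d) ^ 2 =
      Complex.I * ((2 * (2 * x₂ + y₂) * y₂ - 2 * (z₁ + z₂) ^ 2
        - 2 * (z₁ + z₂) * (w₁ + w₂) + (2 * n - 1) * (w₁ + w₂) ^ 2 : ℤ) : ℂ) := by
    rw [ha1, hc_add, hB4, hD4, hnC]
    push_cast
    linear_combination (-((z₁ + z₂) + (w₁ + w₂) / 2) ^ 2
      - (4 * n - 1) * ((w₁ + w₂) / 2) ^ 2 : ℂ) * hI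
  have hP6 : (a - starRingEnd ℂ a) ^ 2 + m * (c + starRingEnd ℂ c) ^ 2
      - 2 * m * (b - Complex.I * starRingEnd ℂ b) * (d + Complex.I * starRingEnd ℂ d) =
      ((-(2 * x₂ + y₂) ^ 2 + m * y₂ ^ 2
        + m * (2 * (z₁ - z₂) + (w₁ - w₂)) * (w₁ - w₂) : ℤ) : ℂ) := by
    rw [ha1, hc_add, hB6, hD6]
    push_cast
    linear_combination ((2 * x₂ + y₂) ^ 2
      - m * ((z₁ - z₂) + (w₁ - w₂) / 2) * (w₁ - w₂) : ℂ) * hI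
  have hQ6 : 2 * (a - starRingEnd ℂ a) * (c + starRingEnd ℂ c)
      - (b - Complex.I * starRingEnd ℂ b) ^ 2 - m * (d + Complex.I * starRingEnd ℂ d) ^ 2 =
      Complex.I * ((2 * (2 * x₂ + y₂) * y₂ + 2 * (z₁ - z₂) ^ 2
        + 2 * (z₁ - z₂) * (w₁ - w₂) - (2 * n - 1) * (w₁ - w₂) ^ 2 : ℤ) : ℂ) := by
    rw [ha1, hc_add, hB6, hD6, hnC]
    push_cast
    linear_combination (-((z₁ - z₂) + (w₁ - w₂) / 2) ^ 2
      - (4 * n - 1) * ((w₁ - w₂) / 2) ^ 2 : ℂ) * hI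
  rw [hP3, hQ3] at hS3
  rw [hP4, hQ4] at hS4
  rw [hP5, hQ5] at hS5
  rw [hP6, hQ6] at hS6
  rw [mul_pow, hI, neg_one_mul, mul_neg, sub_neg_eq_add] at hS4 hS6
  refine ⟨_, _, _, _, _, _, hS1.trans (natCast_sq_mul_intCast ..),
    hS2.trans (sixteen_mul_natCast_mul_neg ..), hS3.trans (sq_sub_natCast_mul_sq ..),
    hS4.trans (sq_add_natCast_mul_sq ..), hS5.trans (sq_sub_natCast_mul_sq ..),
    hS6.trans (sq_add_natCast_mul_sq ..), dvd_mul_right _ _,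
    dvd_mul_right _ _, four_dvd_sq_add_mul_sq hn
      (u := -2 * x₂ ^ 2 - 4 * x₂ * y₂ + (2 * n - 2) * y₂ ^ 2
        - (4 * n - 1) * (z₁ + z₂) * (w₁ + w₂) + (z₁ + z₂) ^ 2 + (z₁ + z₂) * (w₁ + w₂)
        + (1 - 3 * n) * (w₁ + w₂) ^ 2) ?_,
    four_dvd_sq_add_mul_sq hn
      (u := -2 * x₂ ^ 2 - 4 * x₂ * y₂ + (2 * n - 2) * y₂ ^ 2
        + (4 * n - 1) * (z₁ - z₂) * (w₁ - w₂) - (z₁ - z₂) ^ 2 - (z₁ - z₂) * (w₁ - w₂)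
        + (3 * n - 1) * (w₁ - w₂) ^ 2) ?_⟩
  · rw [hn]
    ring
  · rw [hn]
    ring
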